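/- (Ko–Lee) For integers u, v, w and ε ∈ {+1, −1}, the braids σ₁ᵘ σ₂ᵛ σ₁ʷ σ₂^ε and σ₁ʷ σ₂ᵛ σ₁ᵘ σ₂^ε lie in distinct conjugacy classes of B₃ (i.e. the associated flype is non-degenerate) if and only if |v| ≥ 2, the three integers u, v+ε, w are pairwise distinct, and neither u nor w belongs to {0, ε, 2ε}. -/

import Mathlib

/-- The single braid relation `σ₁σ₂σ₁ = σ₂σ₁σ₂` for the classical presentation of `B₃`. -/
def braidRels : Set (FreeGroup (Fin 2)) :=
  { FreeGroup.of 0 * FreeGroup.of 1 * FreeGroup.of 0 *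
      (FreeGroup.of 1 * FreeGroup.of 0 * FreeGroup.of 1)⁻¹ }

/-- The braid group `B₃ = ⟨σ₁, σ₂ | σ₁σ₂σ₁ = σ₂σ₁σ₂⟩`. -/
abbrev B3 := PresentedGroup braidRels

/-- The classical generators `σ₁ = σ 0`, `σ₂ = σ 1` of `B₃`. -/
def σ (i : Fin 2) : B3 := PresentedGroup.of i

section Group

variable {G : Type*} [Group G]

theorem isConj_mul_swap (x y : G) : IsConj (x * y) (y * x) :=
  isConj_iff.2 ⟨y, by group⟩

theorem isConj_of_eq_of_eq {x y x' y' : G} (h : IsConj x y) (hx : x' = x) (hy : y' = y) :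
    IsConj x' y' := by
  rwa [hx, hy]

theorem isConj_central_mul_iff {z : G} (hz : ∀ g, Commute z g) {x y : G} :
    IsConj (z * x) (z * y) ↔ IsConj x y := by
  simp only [isConj_iff]
  refine exists_congr fun c => ?_
  rw [← mul_assoc, ← (hz c).eq, mul_assoc z, mul_assoc z, mul_right_inj]

/-- The product `d sᵖ d s^q d sʳ`. -/
def tri (s d : G) (p q r : ℤ) : G := d * s ^ p * (d * s ^ q) * (d * s ^ r)

theorem map_tri {H : Type*} [Group H] (f : G →* H) (s d : G) (p q r : ℤ) :
    f (tri s d p q r) = tri (f s) (f d) p q r := by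
  simp [tri]

theorem isConj_tri_rotate (s d : G) (p q r : ℤ) :
    IsConj (tri s d p q r) (tri s d q r p) := by
  have h := isConj_mul_swap (d * s ^ p) (d * s ^ q * (d * s ^ r))
  rwa [← mul_assoc] at h

/-- Whether `d sᵖ d s^q d sʳ` is conjugate to its reversal. -/
def TriReversible (s d : G) (p q r : ℤ) : Prop :=
  IsConj (tri s d p q r) (tri s d p r q)

theorem triReversible_rotate {s d : G} {p q r : ℤ} :
    TriReversible s d p q r ↔ TriReversible s d q r p := by
  have h1 := isConj_tri_rotate s d p q r
  have h2 := isConj_tri_rotate s d q p r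
  have h3 := isConj_tri_rotate s d p r q
  exact ⟨fun h => (h1.symm.trans h).trans h2.symm,
    fun h => (h1.trans h).trans h2⟩

theorem TriReversible.map {H : Type*} [Group H] (f : G →* H) {s d : G} {p q r : ℤ}
    (h : TriReversible s d p q r) : TriReversible (f s) (f d) p q r := by
  have := f.map_isConj h
  rwa [map_tri, map_tri] at this

theorem triReversible_self (s d : G) (p q : ℤ) : TriReversible s d p q q :=
  IsConj.refl _

theorem triReversible_zero {s d : G} (hz : ∀ g, Commute (d * d) g) (q r : ℤ) :
    TriReversible s d 0 q r := by
  have key : ∀ q r : ℤ, IsConj (tri s d 0 q r) (d * d * (d * s ^ (q + r))) := by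
    intro q r
    have : tri s d 0 q r = d * d * (s ^ q * (d * s ^ r)) := by
      simp only [tri, zpow_zero]; group
    rw [this, isConj_central_mul_iff hz, add_comm, zpow_add, ← mul_assoc d]
    exact isConj_mul_swap _ _
  exact (key q r).trans (add_comm r q ▸ (key r q).symm)

theorem isConj_tri_of_mul_eq {s d z : G} (hz : ∀ g, Commute z g) (p e q r : ℤ)
    (h : d * s ^ p * d = z * (s ^ e * d * s ^ e)) :
    IsConj (tri s d p q r) (z * (d * s ^ (q + e) * (d * s ^ (r + e)))) := by
  have : tri s d p q r = z * (s ^ e * (d * s ^ (e + q) * (d * s ^ r))) := by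
    simp only [tri, ← mul_assoc] at h ⊢
    rw [h, zpow_add]
    simp only [mul_assoc]
  rw [this, isConj_central_mul_iff hz, add_comm q, zpow_add s r]
  have := isConj_mul_swap (s ^ e) (d * s ^ (e + q) * (d * s ^ r))
  simpa only [mul_assoc] using this

theorem triReversible_of_mul_eq {s d z : G} (hz : ∀ g, Commute z g) (p e q r : ℤ)
    (h : d * s ^ p * d = z * (s ^ e * d * s ^ e)) :
    TriReversible s d p q r :=
  ((isConj_tri_of_mul_eq hz p e q r h).trans
    ((isConj_central_mul_iff hz).2 (isConj_mul_swap _ _))).trans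
    (isConj_tri_of_mul_eq hz p e r q h).symm

theorem triReversible_of_abs_lt {s d : G} (hz : ∀ g, Commute (d * d) g)
    (hsd : d * s⁻¹ * d = s * d * s) {p : ℤ} (hp : |p| < 2) (q r : ℤ) :
    TriReversible s d p q r := by
  obtain rfl | rfl | rfl : p = 0 ∨ p = 1 ∨ p = -1 := by
    rw [abs_lt] at hp; omega
  · exact triReversible_zero hz q r
  · refine triReversible_of_mul_eq hz 1 (-1) q r ?_
    have h : s⁻¹ * d⁻¹ * s⁻¹ = d⁻¹ * s * d⁻¹ := by
      simpa [mul_assoc] using (congrArg (·⁻¹) hsd).symm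
    have h2 : s⁻¹ * (d * d) * d⁻¹ * s⁻¹ = d * d * (d⁻¹ * s * d⁻¹) := by
      rw [← h, ← (hz s⁻¹).eq]; group
    calc d * s ^ (1 : ℤ) * d = d * s * d⁻¹ * (d * d) := by group
      _ = d * d * (d * s * d⁻¹) := ((hz _).eq).symm
      _ = d * d * (s⁻¹ * (d * d) * d⁻¹ * s⁻¹) := by rw [h2]; group
      _ = _ := by group
  · refine triReversible_of_mul_eq (fun g => Commute.one_left g) (-1) 1 q r ?_
    simpa using hsd

theorem triReversible_of_degenerate {s d : G} (hz : ∀ g, Commute (d * d) g)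
    (hsd : d * s⁻¹ * d = s * d * s) {p q r : ℤ}
    (h : |p| < 2 ∨ |q| < 2 ∨ |r| < 2 ∨ p = q ∨ q = r ∨ p = r) :
    TriReversible s d p q r := by
  rcases h with h | h | h | rfl | rfl | rfl
  · exact triReversible_of_abs_lt hz hsd h _ _
  · exact triReversible_rotate.2 (triReversible_of_abs_lt hz hsd h _ _)
  · exact triReversible_rotate.1 (triReversible_of_abs_lt hz hsd h _ _)
  · exact triReversible_rotate.1 (triReversible_self _ _ _ _)
  · exact triReversible_self _ _ _ _
  · exact triReversible_rotate.2 (triReversible_self _ _ _ _)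

end Group

section Braid

theorem braid_rel : σ 0 * σ 1 * σ 0 = σ 1 * σ 0 * σ 1 := by
  have h : (PresentedGroup.mk braidRels) (FreeGroup.of 0 * FreeGroup.of 1 * FreeGroup.of 0 *
      (FreeGroup.of 1 * FreeGroup.of 0 * FreeGroup.of 1)⁻¹) = 1 :=
    PresentedGroup.one_of_mem rfl
  rw [map_mul, map_inv] at h
  exact mul_inv_eq_one.1 h

/-- The half twist `σ₁σ₂σ₁`. -/
def halfTwist : B3 := σ 0 * σ 1 * σ 0

theorem halfTwist_mul_zero : halfTwist * σ 0 = σ 1 * halfTwist := by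
  rw [halfTwist]; nth_rw 1 [braid_rel]; simp only [mul_assoc]

theorem halfTwist_mul_one : halfTwist * σ 1 = σ 0 * halfTwist := by
  rw [halfTwist]; nth_rw 2 [braid_rel]; simp only [mul_assoc]

theorem commute_halfTwist_sq (g : B3) : Commute (halfTwist * halfTwist) g := by
  have h : g ∈ Subgroup.closure (Set.range (PresentedGroup.of (rels := braidRels))) := by
    rw [PresentedGroup.closure_range_of]; trivial
  induction h using Subgroup.closure_induction with
  | mem x hx =>
    obtain ⟨i, rfl⟩ := hx
    change Commute _ (σ i)
    fin_cases i
    · change halfTwist * halfTwist * σ 0 = σ 0 * (halfTwist * halfTwist)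
      rw [mul_assoc, halfTwist_mul_zero, ← mul_assoc, halfTwist_mul_one, mul_assoc]
    · change halfTwist * halfTwist * σ 1 = σ 1 * (halfTwist * halfTwist)
      rw [mul_assoc, halfTwist_mul_one, ← mul_assoc, halfTwist_mul_zero, mul_assoc]
  | one => exact Commute.one_right _
  | mul x y _ _ hx hy => exact hx.mul_right hy
  | inv x _ hx => exact hx.inv_right

theorem halfTwist_mul_inv_mul : halfTwist * (σ 0)⁻¹ * halfTwist = σ 0 * halfTwist * σ 0 := by
  have : halfTwist * (σ 0)⁻¹ = σ 0 * σ 1 := by rw [halfTwist]; group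
  rw [this, mul_assoc, ← halfTwist_mul_zero, mul_assoc]

/-- Up to conjugacy, `σ₁ᵘσ₂ᵛσ₁ʷσ₂` is a central multiple of a three-block product. -/
theorem isConj_flype_tri (u v w : ℤ) :
    IsConj (σ 0 ^ u * σ 1 ^ v * σ 0 ^ w * σ 1)
      ((halfTwist * halfTwist)⁻¹ * tri (σ 0) halfTwist (u - 1) v (w - 1)) := by
  have hz := commute_halfTwist_sq
  have h1 : σ 1 = (σ 0)⁻¹ * halfTwist * (σ 0)⁻¹ := by rw [halfTwist]; group
  have h2 : σ 1 = halfTwist * σ 0 * halfTwist⁻¹ := by rw [halfTwist_mul_zero]; group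
  have h3 : σ 1 ^ v = halfTwist * σ 0 ^ v * halfTwist⁻¹ := by rw [h2, conj_zpow]
  rw [isConj_iff]
  refine ⟨halfTwist * (σ 0)⁻¹, ?_⟩
  rw [h3, h1, eq_inv_mul_iff_mul_eq, (hz _).eq, tri]
  have h4 : halfTwist⁻¹ * σ 0 ^ w * (σ 0)⁻¹ * (halfTwist * halfTwist) =
      halfTwist * σ 0 ^ w * (σ 0)⁻¹ := by
    rw [mul_assoc _ (σ 0)⁻¹, ← (hz _).eq, mul_assoc, ← mul_assoc (σ 0 ^ w), ← (hz _).eq]; group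
  calc _ = halfTwist * (σ 0)⁻¹ * σ 0 ^ u * halfTwist * σ 0 ^ v *
        (halfTwist⁻¹ * σ 0 ^ w * (σ 0)⁻¹ * (halfTwist * halfTwist)) := by
        group
    _ = _ := by rw [h4]; group

theorem isConj_flype_iff (u v w : ℤ) :
    IsConj (σ 0 ^ u * σ 1 ^ v * σ 0 ^ w * σ 1) (σ 0 ^ w * σ 1 ^ v * σ 0 ^ u * σ 1) ↔
      TriReversible (σ 0) halfTwist v (w - 1) (u - 1) := by
  have key : ∀ u w : ℤ, IsConj (σ 0 ^ u * σ 1 ^ v * σ 0 ^ w * σ 1)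
      ((halfTwist * halfTwist)⁻¹ * tri (σ 0) halfTwist v (w - 1) (u - 1)) := fun u w =>
    (isConj_flype_tri u v w).trans <|
      (isConj_central_mul_iff fun g => (commute_halfTwist_sq g).inv_left).2
        (isConj_tri_rotate _ _ _ _ _)
  refine Iff.trans ?_ (isConj_central_mul_iff fun g => (commute_halfTwist_sq g).inv_left)
  exact ⟨fun h => ((key u w).symm.trans h).trans (key w u),
    fun h => ((key u w).trans h).trans (key w u).symm⟩

/-- The automorphism of `B₃` inverting both generators. -/
def mirror : B3 →* B3 :=
  PresentedGroup.toGroup (f := fun i => (σ i)⁻¹) (by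
    rintro _ rfl
    simp only [map_mul, map_inv, FreeGroup.lift_apply_of]
    rw [mul_inv_eq_one]
    simpa [mul_assoc] using congrArg (·⁻¹) braid_rel)

theorem mirror_σ (i : Fin 2) : mirror (σ i) = (σ i)⁻¹ :=
  PresentedGroup.toGroup.of _

theorem isConj_flype_neg (u v w ε : ℤ)
    (h : IsConj (σ 0 ^ u * σ 1 ^ v * σ 0 ^ w * σ 1 ^ ε)
      (σ 0 ^ w * σ 1 ^ v * σ 0 ^ u * σ 1 ^ ε)) :
    IsConj (σ 0 ^ (-u) * σ 1 ^ (-v) * σ 0 ^ (-w) * σ 1 ^ (-ε))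
      (σ 0 ^ (-w) * σ 1 ^ (-v) * σ 0 ^ (-u) * σ 1 ^ (-ε)) := by
  simpa only [map_mul, map_zpow, mirror_σ, inv_zpow'] using mirror.map_isConj h

end Braid

section Words

open Matrix Matrix.SpecialLinearGroup

/-- The elementary matrices `(1 1; 0 1)` for `true` and `(1 0; 1 1)` for `false`. -/
def letter : Bool → SpecialLinearGroup (Fin 2) ℤ
  | true => ⟨!![1, 1; 0, 1], by simp⟩
  | false => ⟨!![1, 0; 1, 1], by simp⟩

theorem coe_letter_true : (letter true : Matrix (Fin 2) (Fin 2) ℤ) = !![1, 1; 0, 1] := rfl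

theorem coe_letter_false : (letter false : Matrix (Fin 2) (Fin 2) ℤ) = !![1, 0; 1, 1] := rfl

/-- The product of the elementary matrices spelled by a word. -/
def wordProd (x : List Bool) : SpecialLinearGroup (Fin 2) ℤ := (x.map letter).prod

@[simp] theorem wordProd_nil : wordProd [] = 1 := rfl

@[simp] theorem wordProd_cons (m : Bool) (x : List Bool) :
    wordProd (m :: x) = letter m * wordProd x := by simp [wordProd]

@[simp] theorem wordProd_append (x y : List Bool) :
    wordProd (x ++ y) = wordProd x * wordProd y := by simp [wordProd]

@[simp] theorem wordProd_replicate (n : ℕ) (m : Bool) :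
    wordProd (List.replicate n m) = letter m ^ n := by simp [wordProd]

variable (g : SpecialLinearGroup (Fin 2) ℤ) (i : Fin 2)

@[simp] theorem mul_letter_true_zero : (g * letter true) i 0 = g i 0 := by
  simp [coe_mul, coe_letter_true, mul_apply]

@[simp] theorem mul_letter_true_one : (g * letter true) i 1 = g i 0 + g i 1 := by
  simp [coe_mul, coe_letter_true, mul_apply]

@[simp] theorem mul_letter_false_zero : (g * letter false) i 0 = g i 0 + g i 1 := by
  simp [coe_mul, coe_letter_false, mul_apply]

@[simp] theorem mul_letter_false_one : (g * letter false) i 1 = g i 1 := by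
  simp [coe_mul, coe_letter_false, mul_apply]

@[simp] theorem letter_true_mul_zero : (letter true * g) 0 i = g 0 i + g 1 i := by
  simp [coe_mul, coe_letter_true, mul_apply]

@[simp] theorem letter_true_mul_one : (letter true * g) 1 i = g 1 i := by
  simp [coe_mul, coe_letter_true, mul_apply]

@[simp] theorem letter_false_mul_zero : (letter false * g) 0 i = g 0 i := by
  simp [coe_mul, coe_letter_false, mul_apply]

@[simp] theorem letter_false_mul_one : (letter false * g) 1 i = g 0 i + g 1 i := by
  simp [coe_mul, coe_letter_false, mul_apply]

variable {g}

theorem det_eq (g : SpecialLinearGroup (Fin 2) ℤ) : g 0 0 * g 1 1 - g 0 1 * g 1 0 = 1 := by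
  rw [← det_fin_two]; exact g.det_coe

theorem wordProd_nonneg (x : List Bool) (i j : Fin 2) : 0 ≤ wordProd x i j := by
  induction x generalizing i j with
  | nil => fin_cases i <;> fin_cases j <;> simp
  | cons m x ih =>
    have h0 := ih 0 j
    have h1 := ih 1 j
    cases m <;> fin_cases i <;> simp <;> linarith

theorem diag_pos_of_nonneg (hg : ∀ i j, 0 ≤ g i j) : 0 < g 0 0 ∧ 0 < g 1 1 := by
  have h := det_eq g
  have h1 := mul_nonneg (hg 0 1) (hg 1 0)
  exact (pos_and_pos_or_neg_and_neg_of_mul_pos (by linarith : 0 < g 0 0 * g 1 1)).resolve_right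
    fun h => absurd (hg 0 0) (by linarith [h.1])

theorem wordProd_zero_one_pos {x : List Bool} (hx : true ∈ x) : 0 < wordProd x 0 1 := by
  induction x with
  | nil => simp at hx
  | cons m x ih =>
    have h0 := wordProd_nonneg x 0 1
    have h1 := (diag_pos_of_nonneg (wordProd_nonneg x)).2
    cases m
    · simpa using ih (by simpa using hx)
    · simp; linarith

theorem wordProd_one_zero_pos {x : List Bool} (hx : false ∈ x) : 0 < wordProd x 1 0 := by
  induction x with
  | nil => simp at hx
  | cons m x ih =>
    have h0 := wordProd_nonneg x 1 0
    have h1 := (diag_pos_of_nonneg (wordProd_nonneg x)).1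
    cases m
    · simp; linarith
    · simpa using ih (by simpa using hx)

theorem letter_mul_inj {m m' : Bool} {a b : SpecialLinearGroup (Fin 2) ℤ}
    (ha : ∀ i j, 0 ≤ a i j) (hb : ∀ i j, 0 ≤ b i j) (h : letter m * a = letter m' * b) :
    m = m' := by
  have h00 := congrArg (fun g : SpecialLinearGroup (Fin 2) ℤ => g 0 0) h
  have h10 := congrArg (fun g : SpecialLinearGroup (Fin 2) ℤ => g 1 0) h
  have h01 := congrArg (fun g : SpecialLinearGroup (Fin 2) ℤ => g 0 1) h
  have h11 := congrArg (fun g : SpecialLinearGroup (Fin 2) ℤ => g 1 1) h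
  have ha' := diag_pos_of_nonneg ha
  have hb' := diag_pos_of_nonneg hb
  have := ha 0 1
  have := ha 1 0
  have := hb 0 1
  have := hb 1 0
  cases m <;> cases m' <;> simp at * <;> linarith

theorem letter_mul_ne_one {m : Bool} {a : SpecialLinearGroup (Fin 2) ℤ}
    (ha : ∀ i j, 0 ≤ a i j) : letter m * a ≠ 1 := by
  intro h
  have h10 := congrArg (fun g : SpecialLinearGroup (Fin 2) ℤ => g 1 0) h
  have h01 := congrArg (fun g : SpecialLinearGroup (Fin 2) ℤ => g 0 1) h
  have ha' := diag_pos_of_nonneg ha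
  have := ha 0 1
  have := ha 1 0
  cases m <;> simp at * <;> linarith

theorem wordProd_injective : Function.Injective wordProd := by
  intro x
  induction x with
  | nil =>
    rintro (_ | ⟨m, y⟩) h
    · rfl
    · exact absurd h.symm (by simpa using letter_mul_ne_one (wordProd_nonneg y))
  | cons m x ih =>
    rintro (_ | ⟨m', y⟩) h
    · exact absurd h (by simpa using letter_mul_ne_one (wordProd_nonneg x))
    · rw [wordProd_cons, wordProd_cons] at h
      obtain rfl := letter_mul_inj (wordProd_nonneg x) (wordProd_nonneg y) h
      rw [ih (mul_left_cancel h)]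

theorem eq_one_or_exists_letter_mul (hg : ∀ i j, 0 ≤ g i j) :
    g = 1 ∨ ∃ m a, g = letter m * a ∧ (∀ i j, 0 ≤ a i j) ∧
      a 0 0 + a 0 1 + a 1 0 + a 1 1 < g 0 0 + g 0 1 + g 1 0 + g 1 1 := by
  have hd := det_eq g
  have hp := diag_pos_of_nonneg hg
  have h01 := hg 0 1
  have h10 := hg 1 0
  by_cases h1 : g 1 0 ≤ g 0 0 ∧ g 1 1 ≤ g 0 1
  · right
    obtain ⟨a, ha⟩ : ∃ a : SpecialLinearGroup (Fin 2) ℤ, (a : Matrix (Fin 2) (Fin 2) ℤ) =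
        !![g 0 0 - g 1 0, g 0 1 - g 1 1; g 1 0, g 1 1] :=
      ⟨⟨_, by rw [det_fin_two_of]; linarith⟩, rfl⟩
    refine ⟨true, a, ?_, ?_, ?_⟩
    · ext i j
      fin_cases i <;> fin_cases j <;> simp [ha]
    · intro i j
      fin_cases i <;> fin_cases j <;> simp [ha] <;> omega
    · simp [ha]; omega
  by_cases h2 : g 0 0 ≤ g 1 0 ∧ g 0 1 ≤ g 1 1
  · right
    obtain ⟨a, ha⟩ : ∃ a : SpecialLinearGroup (Fin 2) ℤ, (a : Matrix (Fin 2) (Fin 2) ℤ) =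
        !![g 0 0, g 0 1; g 1 0 - g 0 0, g 1 1 - g 0 1] :=
      ⟨⟨_, by rw [det_fin_two_of]; linarith⟩, rfl⟩
    refine ⟨false, a, ?_, ?_, ?_⟩
    · ext i j
      fin_cases i <;> fin_cases j <;> simp [ha]
    · intro i j
      fin_cases i <;> fin_cases j <;> simp [ha] <;> omega
    · simp [ha]; omega
  left
  have h3 : g 1 0 + 1 ≤ g 0 0 ∧ g 0 1 + 1 ≤ g 1 1 := by
    by_contra h3
    have h4 : g 0 0 + 1 ≤ g 1 0 ∧ g 1 1 + 1 ≤ g 0 1 := by omega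
    nlinarith
  have h4 : g 0 1 = 0 := by nlinarith
  have h5 : g 1 0 = 0 := by nlinarith
  rw [h4, zero_mul, sub_zero] at hd
  have h6 : g 0 0 = 1 := by nlinarith
  have h7 : g 1 1 = 1 := by nlinarith
  ext i j
  fin_cases i <;> fin_cases j <;> simp [*]

theorem isRotated_of_nonneg_mul_eq {h : SpecialLinearGroup (Fin 2) ℤ} (hh : ∀ i j, 0 ≤ h i j)
    {x y : List Bool} (he : h * wordProd x = wordProd y * h) : x ~r y := by
  obtain ⟨n, hn⟩ : ∃ n : ℕ, h 0 0 + h 0 1 + h 1 0 + h 1 1 ≤ n := ⟨_, Int.self_le_toNat _⟩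
  induction n generalizing h y with
  | zero =>
    have := diag_pos_of_nonneg hh
    push_cast at hn
    linarith [hh 0 1, hh 1 0]
  | succ n ih =>
    obtain rfl | ⟨m, a, rfl, ha, hlt⟩ := eq_one_or_exists_letter_mul hh
    · rw [wordProd_injective (by simpa using he : wordProd x = wordProd y)]
    rcases y with _ | ⟨m', y⟩
    · rw [wordProd_nil, one_mul, mul_eq_left] at he
      rw [wordProd_injective (he.trans wordProd_nil.symm)]
    have hnn : ∀ {a b : SpecialLinearGroup (Fin 2) ℤ}, (∀ i j, 0 ≤ a i j) →
        (∀ i j, 0 ≤ b i j) → ∀ i j, 0 ≤ (a * b) i j := by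
      intro a b ha hb i j
      rw [coe_mul, mul_apply]
      exact Finset.sum_nonneg fun k _ => mul_nonneg (ha i k) (hb k j)
    rw [wordProd_cons, mul_assoc, mul_assoc] at he
    obtain rfl := letter_mul_inj (hnn ha (wordProd_nonneg x)) (hnn (wordProd_nonneg y) hh) he
    have he' : a * wordProd x = wordProd (y ++ [m]) * a := by
      simpa [mul_assoc] using mul_left_cancel he
    exact (ih ha he' (by push_cast at hn; omega)).trans
      (by simpa using List.isRotated_append (l := y) (l' := [m]))

/-- The two integers lie weakly on the same side of zero. -/
def SameSign (a b : ℤ) : Prop := 0 ≤ a ∧ 0 ≤ b ∨ a ≤ 0 ∧ b ≤ 0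

theorem exists_sameSign_row (i : Fin 2) {x y : List Bool} (hx : x ≠ [])
    (he : g * wordProd x = wordProd y * g) :
    ∃ g' x', x ~r x' ∧ g' * wordProd x' = wordProd y * g' ∧ SameSign (g' i 0) (g' i 1) ∧
      ∀ k, SameSign (g k 0) (g k 1) → SameSign (g' k 0) (g' k 1) := by
  obtain ⟨n, hn⟩ : ∃ n : ℕ, |g i 0| + |g i 1| ≤ n := ⟨_, Int.self_le_toNat _⟩
  induction n generalizing g x with
  | zero => exact ⟨g, x, .refl x, he, by unfold SameSign; grind, fun _ => id⟩
  | succ n ih =>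
    by_cases hs : SameSign (g i 0) (g i 1)
    · exact ⟨g, x, .refl x, he, hs, fun _ => id⟩
    obtain ⟨m, x, rfl⟩ := List.exists_cons_of_ne_nil hx
    have he' : g * letter m * wordProd (x ++ [m]) = wordProd y * (g * letter m) := by
      rw [← mul_assoc, ← he]; simp [mul_assoc]
    have hrow : ∀ k, SameSign (g k 0) (g k 1) →
        SameSign ((g * letter m) k 0) ((g * letter m) k 1) := by
      intro k
      unfold SameSign
      cases m <;> simp <;> omega
    have hrot : (m :: x) ~r (x ++ [m]) := List.isRotated_append (l := [m]) (l' := x)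
    have hlt : SameSign ((g * letter m) i 0) ((g * letter m) i 1) ∨
        |(g * letter m) i 0| + |(g * letter m) i 1| ≤ n := by
      push_cast at hn
      unfold SameSign at hs ⊢
      cases m <;> simp <;> grind
    obtain hlt | hlt := hlt
    · exact ⟨_, _, hrot, he', hlt, hrow⟩
    · obtain ⟨g', x', h1, h2, h3, h4⟩ := ih (by simp) he' hlt
      exact ⟨g', x', hrot.trans h1, h2, h3, fun k hk => h4 k (hrow k hk)⟩

theorem not_opposite_rows {h X Y : SpecialLinearGroup (Fin 2) ℤ}
    (h00 : 0 ≤ h 0 0) (h01 : 0 ≤ h 0 1) (h10 : h 1 0 ≤ 0) (h11 : h 1 1 ≤ 0)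
    (hX01 : 0 < X 0 1) (hX10 : 0 < X 1 0) (hY01 : 0 ≤ Y 0 1) (hY10 : 0 ≤ Y 1 0)
    (he : h * X = Y * h) : False := by
  have hd := det_eq h
  have e : ∀ i j, h i 0 * X 0 j + h i 1 * X 1 j = Y i 0 * h 0 j + Y i 1 * h 1 j := by
    intro i j
    have := congrArg (fun g : SpecialLinearGroup (Fin 2) ℤ => g i j) he
    simpa [coe_mul, mul_apply, Fin.sum_univ_two] using this
  replace hY01 : 0 ≤ h 0 0 * (h 0 0 * X 0 1 + h 0 1 * X 1 1) -
      h 0 1 * (h 0 0 * X 0 0 + h 0 1 * X 1 0) := by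
    convert hY01 using 1
    linear_combination h 0 0 * e 0 1 - h 0 1 * e 0 0 + Y 0 1 * hd
  replace hY10 : 0 ≤ h 1 1 * (h 1 0 * X 0 0 + h 1 1 * X 1 0) -
      h 1 0 * (h 1 0 * X 0 1 + h 1 1 * X 1 1) := by
    convert hY10 using 1
    linear_combination h 1 1 * e 1 0 - h 1 0 * e 1 1 + Y 1 0 * hd
  clear he e
  generalize h 0 0 = a, h 0 1 = b, h 1 0 = c, h 1 1 = d at *
  generalize X 0 1 = β, X 1 0 = γ, X 0 0 = p, X 1 1 = q at *
  obtain ⟨c, rfl⟩ : ∃ c', c = -c' := ⟨-c, by simp⟩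
  obtain ⟨d, rfl⟩ : ∃ c', d = -c' := ⟨-d, by simp⟩
  have hc : 0 ≤ c := by linarith
  have hd' : 0 ≤ d := by linarith
  have h1 := mul_nonneg hY01 (mul_nonneg hc hd')
  have h2 := mul_nonneg hY10 (mul_nonneg h00 h01)
  have h3 : β * (a * c) + γ * (b * d) ≤ 0 := by
    have : (β * (a * c) + γ * (b * d)) * (b * c - a * d) ≤ 0 := by linarith
    rwa [show b * c - a * d = 1 by linarith, mul_one] at this
  have h4 : a * c = 0 := by nlinarith [mul_nonneg h00 hc, mul_nonneg h01 hd']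
  have h5 : b * d = 0 := by nlinarith [mul_nonneg h00 hc, mul_nonneg h01 hd']
  have h6 : b ≠ 0 := by rintro rfl; nlinarith [mul_nonneg h00 hd']
  have h7 : c ≠ 0 := by rintro rfl; nlinarith [mul_nonneg h00 hd']
  obtain rfl : a = 0 := by simpa [h7] using h4
  obtain rfl : d = 0 := by simpa [h6] using h5
  nlinarith [mul_pos hX10 (mul_self_pos.2 h6)]

theorem isRotated_of_isConj_wordProd {x y : List Bool} (hxt : true ∈ x) (hxf : false ∈ x)
    (h : IsConj (wordProd x) (wordProd y)) : x ~r y := by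
  obtain ⟨g, hg⟩ := isConj_iff.1 h
  obtain ⟨g, x₁, hx₁, hg, h0, -⟩ := exists_sameSign_row 0 (List.ne_nil_of_mem hxt)
    (mul_inv_eq_iff_eq_mul.1 hg)
  obtain ⟨g, x₂, hx₂, hg, h1, h0'⟩ := exists_sameSign_row 1
    (List.ne_nil_of_mem (hx₁.perm.mem_iff.1 hxt)) hg
  replace h0 := h0' 0 h0
  have hx := hx₁.trans hx₂
  have hX01 := wordProd_zero_one_pos (hx.perm.mem_iff.1 hxt)
  have hX10 := wordProd_one_zero_pos (hx.perm.mem_iff.1 hxf)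
  have hg' : -g * wordProd x₂ = wordProd y * -g := by simpa using hg
  refine hx.trans ?_
  rcases h0 with ⟨h00, h01⟩ | ⟨h00, h01⟩ <;> rcases h1 with ⟨h10, h11⟩ | ⟨h10, h11⟩
  · refine isRotated_of_nonneg_mul_eq (h := g) (fun i j => ?_) hg
    fin_cases i <;> fin_cases j <;> assumption
  · exact (not_opposite_rows h00 h01 h10 h11 hX01 hX10 (wordProd_nonneg y _ _)
      (wordProd_nonneg y _ _) hg).elim
  · exact (not_opposite_rows (h := -g) (by simpa) (by simpa) (by simpa) (by simpa) hX01 hX10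
      (wordProd_nonneg y _ _) (wordProd_nonneg y _ _) hg').elim
  · refine isRotated_of_nonneg_mul_eq (h := -g) (fun i j => ?_) hg'
    fin_cases i <;> fin_cases j <;> simpa

end Words

section Representation

open Matrix Matrix.SpecialLinearGroup

theorem isConj_neg_iff {x y : SpecialLinearGroup (Fin 2) ℤ} : IsConj (-x) (-y) ↔ IsConj x y := by
  simp [isConj_iff]

/-- The matrix `(0 1; -1 0)`, the image of the half twist. -/
def flipMatrix : SpecialLinearGroup (Fin 2) ℤ := ⟨!![0, 1; -1, 0], by simp⟩

theorem flipMatrix_inv : flipMatrix⁻¹ = -flipMatrix := by decide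

theorem letter_mul_flipMatrix_mul_letter :
    letter true * flipMatrix * letter true = -letter false := by decide

theorem flipMatrix_conj_letter : flipMatrix * (letter true)⁻¹ * flipMatrix⁻¹ = letter false := by
  decide

theorem flipMatrix_mul_zpow_mul_flipMatrix (n : ℕ) :
    flipMatrix * letter true ^ (-n : ℤ) * flipMatrix = -letter false ^ n := by
  rw [← flipMatrix_conj_letter, conj_pow, flipMatrix_inv]
  simp

/-- The reduction of `B₃` to `SL₂(ℤ)` given by the integral Burau representation at `-1`. -/
def toSL : B3 →* SpecialLinearGroup (Fin 2) ℤ :=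
  PresentedGroup.toGroup (f := ![letter true, (letter false)⁻¹]) (by
    rintro _ rfl
    simp only [map_mul, map_inv, FreeGroup.lift_apply_of]
    decide)

theorem toSL_zero : toSL (σ 0) = letter true := PresentedGroup.toGroup.of _

theorem toSL_one : toSL (σ 1) = (letter false)⁻¹ := PresentedGroup.toGroup.of _

theorem toSL_halfTwist : toSL halfTwist = flipMatrix := by
  rw [halfTwist, map_mul, map_mul, toSL_zero, toSL_one]; decide

theorem isConj_tri_inv (p q r : ℤ) :
    IsConj (tri (letter true) flipMatrix p q r)⁻¹
      (-tri (letter true) flipMatrix (-r) (-q) (-p)) := by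
  have h := isConj_mul_swap (letter true ^ (-r) * flipMatrix⁻¹ * letter true ^ (-q) *
    flipMatrix⁻¹ * letter true ^ (-p)) flipMatrix⁻¹
  refine isConj_of_eq_of_eq h ?_ ?_
  · simp only [tri]; group
  · simp [tri, flipMatrix_inv, mul_assoc]

theorem triReversible_neg {p q r : ℤ} (h : TriReversible (letter true) flipMatrix p q r) :
    TriReversible (letter true) flipMatrix (-p) (-q) (-r) := by
  have h' : IsConj (tri (letter true) flipMatrix p q r)⁻¹
      (tri (letter true) flipMatrix p r q)⁻¹ := by
    obtain ⟨c, hc⟩ := isConj_iff.1 h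
    exact isConj_iff.2 ⟨c, by rw [← hc, conj_inv]⟩
  have := isConj_neg_iff.1 (((isConj_tri_inv p q r).symm.trans h').trans (isConj_tri_inv p r q))
  exact (isConj_tri_rotate _ _ _ _ _).trans ((this.symm).trans (isConj_tri_rotate _ _ _ _ _).symm)

theorem isConj_tri_of_pos (a b c : ℕ) :
    IsConj (tri (letter true) flipMatrix (a + 2) (b + 2) (c + 2))
      (-wordProd (List.replicate a true ++ false :: (List.replicate b true ++
        false :: (List.replicate c true ++ [false])))) := by
  have h := isConj_mul_swap (flipMatrix * letter true)
    (letter true ^ (a + 1) * (flipMatrix * letter true ^ (b + 2)) *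
      (flipMatrix * letter true ^ (c + 2)))
  have h1 : ∀ x, letter true * (flipMatrix * (letter true * x)) = -(letter false * x) := by
    intro x
    rw [← mul_assoc, ← mul_assoc, letter_mul_flipMatrix_mul_letter, neg_mul]
  have h2 := letter_mul_flipMatrix_mul_letter
  rw [mul_assoc] at h2
  refine isConj_of_eq_of_eq h ?_ ?_
  · simp only [tri]; norm_cast; simp only [pow_succ']; simp only [mul_assoc]
  · rw [pow_succ, pow_succ' _ (b + 1), pow_succ _ b, pow_succ' _ (c + 1), pow_succ _ c]
    simp [mul_assoc, h1, h2]

theorem isConj_tri_of_pos_pos_neg (a b n : ℕ) :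
    IsConj (tri (letter true) flipMatrix (a + 1) (b + 1) (-n))
      (wordProd (List.replicate a true ++ false :: (List.replicate b true ++
        List.replicate n false))) := by
  have h := isConj_mul_swap flipMatrix
    (letter true ^ (a + 1) * (flipMatrix * letter true ^ (b + 1)) *
      (flipMatrix * letter true ^ (-n : ℤ)))
  have h1 : ∀ x, letter true * (flipMatrix * (letter true * x)) = -(letter false * x) := by
    intro x
    rw [← mul_assoc, ← mul_assoc, letter_mul_flipMatrix_mul_letter, neg_mul]
  have h2 := flipMatrix_mul_zpow_mul_flipMatrix n
  rw [mul_assoc] at h2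
  refine isConj_of_eq_of_eq h ?_ ?_
  · simp only [tri]; norm_cast; simp only [mul_assoc]
  · rw [pow_succ, pow_succ' _ b]
    simp only [mul_assoc, h1, h2]
    simp [mul_assoc]

theorem exists_getElem?_eq_of_isRotated {α : Type*} {l l' : List α} (h : l ~r l') :
    ∃ n ≤ l.length, ∀ i < l.length,
      l'[i]? = if i + n < l.length then l[i + n]? else l[i + n - l.length]? := by
  obtain ⟨n, hn, rfl⟩ := List.isRotated_iff_mod.1 h
  refine ⟨n, hn, fun i hi => ?_⟩
  rw [List.getElem?_rotate hi]
  split_ifs with hlt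
  · rw [Nat.mod_eq_of_lt hlt]
  · rw [Nat.mod_eq_sub_mod (by omega), Nat.mod_eq_of_lt (by omega)]

theorem eq_of_isRotated_three_runs {a b c : ℕ}
    (h : (List.replicate a true ++ false :: (List.replicate b true ++
        false :: (List.replicate c true ++ [false]))) ~r
      (List.replicate a true ++ false :: (List.replicate c true ++
        false :: (List.replicate b true ++ [false])))) :
    a = b ∨ b = c ∨ a = c := by
  have key : ∀ a b c i : ℕ, (List.replicate a true ++ false :: (List.replicate b true ++
        false :: (List.replicate c true ++ [false])))[i]? = some false ↔
      i = a ∨ i = a + b + 1 ∨ i = a + b + c + 2 := by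
    intro a b c i
    simp only [List.getElem?_append, List.getElem?_cons, List.getElem?_replicate,
      List.length_replicate]
    grind
  obtain ⟨n, hn, h⟩ := exists_getElem?_eq_of_isRotated h
  replace h := fun i hi => congrArg (· = some false) (h i hi)
  simp only [apply_ite (· = some false), key, List.length_append, List.length_cons,
    List.length_replicate, List.length_nil] at h hn
  have h1 := h a (by omega)
  have h2 := h (a + c + 1) (by omega)
  have h3 := h (a + c + b + 2) (by omega)
  clear h
  grind

theorem eq_of_isRotated_two_runs {a b n : ℕ} (ha : 0 < a) (hb : 0 < b) (hn : 2 ≤ n)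
    (h : (List.replicate a true ++ false :: (List.replicate b true ++
        List.replicate n false)) ~r
      (List.replicate b true ++ false :: (List.replicate a true ++
        List.replicate n false))) :
    a = b := by
  have key : ∀ a b i : ℕ, (List.replicate a true ++ false :: (List.replicate b true ++
        List.replicate n false))[i]? = some false ↔
      i = a ∨ a + b + 1 ≤ i ∧ i < a + b + n + 1 := by
    intro a b i
    simp only [List.getElem?_append, List.getElem?_cons, List.getElem?_replicate,
      List.length_replicate]
    grind
  obtain ⟨k, hk, h⟩ := exists_getElem?_eq_of_isRotated h
  replace h := fun i hi => congrArg (· = some false) (h i hi)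
  simp only [apply_ite (· = some false), key, List.length_append, List.length_cons,
    List.length_replicate] at h hk
  have h1 := h a (by omega)
  have h2 := h b (by omega)
  have h3 := h (b + 1) (by omega)
  have h4 := h 0 (by omega)
  have h5 := h (a + b + n) (by omega)
  clear h
  grind

theorem not_triReversible_of_pos {p q r : ℤ} (hp : 2 ≤ p) (hq : 2 ≤ q) (hr : 2 ≤ r)
    (hpq : p ≠ q) (hqr : q ≠ r) (hpr : p ≠ r) :
    ¬ TriReversible (letter true) flipMatrix p q r := by
  obtain ⟨a, rfl⟩ : ∃ a : ℕ, p = a + 2 := ⟨(p - 2).toNat, by omega⟩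
  obtain ⟨b, rfl⟩ : ∃ b : ℕ, q = b + 2 := ⟨(q - 2).toNat, by omega⟩
  obtain ⟨c, rfl⟩ : ∃ c : ℕ, r = c + 2 := ⟨(r - 2).toNat, by omega⟩
  intro h
  have h' := isConj_neg_iff.1
    (((isConj_tri_of_pos a b c).symm.trans h).trans (isConj_tri_of_pos a c b))
  have := eq_of_isRotated_three_runs (isRotated_of_isConj_wordProd (by simp; omega) (by simp) h')
  omega

theorem not_triReversible_of_pos_pos_neg {p q r : ℤ} (hp : 2 ≤ p) (hq : 2 ≤ q) (hr : r ≤ -2)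
    (hpq : p ≠ q) : ¬ TriReversible (letter true) flipMatrix p q r := by
  obtain ⟨a, rfl⟩ : ∃ a : ℕ, p = a + 1 := ⟨(p - 1).toNat, by omega⟩
  obtain ⟨b, rfl⟩ : ∃ b : ℕ, q = b + 1 := ⟨(q - 1).toNat, by omega⟩
  obtain ⟨n, rfl⟩ : ∃ n : ℕ, r = -n := ⟨(-r).toNat, by omega⟩
  intro h
  have h' := (((isConj_tri_of_pos_pos_neg a b n).symm.trans h).trans
    (isConj_tri_rotate _ _ _ _ _).symm).trans (isConj_tri_of_pos_pos_neg b a n)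
  have := eq_of_isRotated_two_runs (by omega) (by omega) (by omega)
    (isRotated_of_isConj_wordProd (by simp; omega) (by simp) h')
  omega

theorem not_triReversible {p q r : ℤ} (hp : 2 ≤ |p|) (hq : 2 ≤ |q|) (hr : 2 ≤ |r|)
    (hpq : p ≠ q) (hqr : q ≠ r) (hpr : p ≠ r) :
    ¬ TriReversible (letter true) flipMatrix p q r := by
  wlog hpos : 0 < p ∧ 0 < q ∨ 0 < q ∧ 0 < r ∨ 0 < p ∧ 0 < r generalizing p q r
  · exact fun h => this (p := -p) (q := -q) (r := -r) (by simpa) (by simpa) (by simpa) (by simpa)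
      (by simpa) (by simpa) (by grind) (triReversible_neg h)
  rw [le_abs] at hp hq hr
  by_cases hall : 0 < p ∧ 0 < q ∧ 0 < r
  · exact not_triReversible_of_pos (by omega) (by omega) (by omega) hpq hqr hpr
  obtain ⟨h1, h2⟩ | ⟨h1, h2⟩ | ⟨h1, h2⟩ := hpos
  · exact not_triReversible_of_pos_pos_neg (by omega) (by omega) (by omega) hpq
  · rw [triReversible_rotate]
    exact not_triReversible_of_pos_pos_neg (by omega) (by omega) (by omega) hqr
  · rw [← triReversible_rotate]
    exact not_triReversible_of_pos_pos_neg (by omega) (by omega) (by omega) hpr.symm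

theorem triReversible_braid_iff {p q r : ℤ} :
    TriReversible (σ 0) halfTwist p q r ↔
      |p| < 2 ∨ |q| < 2 ∨ |r| < 2 ∨ p = q ∨ q = r ∨ p = r := by
  refine ⟨fun h => ?_, triReversible_of_degenerate commute_halfTwist_sq halfTwist_mul_inv_mul⟩
  by_contra! hc
  obtain ⟨hp, hq, hr, hpq, hqr, hpr⟩ := hc
  have h' := h.map toSL
  rw [toSL_zero, toSL_halfTwist] at h'
  exact not_triReversible hp hq hr hpq hqr hpr h'

end Representation

/-- (Ko–Lee) For `u, v, w ∈ ℤ` and `ε = ±1`, the braids `σ₁ᵘσ₂ᵛσ₁ʷσ₂^ε` and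
`σ₁ʷσ₂ᵛσ₁ᵘσ₂^ε` lie in distinct conjugacy classes of `B₃` (i.e. the flype is
non-degenerate) if and only if `|v| ≥ 2`, the integers `u, v+ε, w` are pairwise
distinct, and neither `u` nor `w` lies in `{0, ε, 2ε}`. -/
theorem ko_lee_nondegenerate_flype (u v w ε : ℤ) (hε : ε = 1 ∨ ε = -1) :
    ¬ IsConj (σ 0 ^ u * σ 1 ^ v * σ 0 ^ w * σ 1 ^ ε)
        (σ 0 ^ w * σ 1 ^ v * σ 0 ^ u * σ 1 ^ ε) ↔
      (2 ≤ |v| ∧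
        u ≠ v + ε ∧ u ≠ w ∧ v + ε ≠ w ∧
        u ≠ 0 ∧ u ≠ ε ∧ u ≠ 2 * ε ∧
        w ≠ 0 ∧ w ≠ ε ∧ w ≠ 2 * ε) := by
  wlog hpos : ε = 1 generalizing u v w ε
  · obtain rfl : ε = -1 := hε.resolve_left hpos
    have h := this (-u) (-v) (-w) 1 (.inl rfl) rfl
    have hc : IsConj (σ 0 ^ u * σ 1 ^ v * σ 0 ^ w * σ 1 ^ (-1 : ℤ))
          (σ 0 ^ w * σ 1 ^ v * σ 0 ^ u * σ 1 ^ (-1 : ℤ)) ↔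
        IsConj (σ 0 ^ (-u) * σ 1 ^ (-v) * σ 0 ^ (-w) * σ 1 ^ (1 : ℤ))
          (σ 0 ^ (-w) * σ 1 ^ (-v) * σ 0 ^ (-u) * σ 1 ^ (1 : ℤ)) :=
      ⟨fun h => isConj_flype_neg u v w (-1) h,
        fun h => by simpa only [neg_neg] using isConj_flype_neg _ _ _ _ h⟩
    rw [hc, h, abs_neg]
    omega
  subst hpos
  rw [zpow_one, isConj_flype_iff, triReversible_braid_iff]
  simp only [abs_lt, le_abs]
  omega
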